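/- The subgroup 𝓜 of 𝒢 generated by x, y and s_1 = t_1 t_8 has order 1344 (it is isomorphic to 2^3:L_3(2)); moreover the subgroup S generated by s_1,…,s_7 is a normal subgroup of 𝓜 which is elementary abelian of order 8. -/

import Mathlib

/-!
Symmetric generation of `M₂₂` (Hasan–Lim).  `G` is the quotient of the free
group on three generators `x, y, t` by the normal closure of the relators
`x^7, y^2, (xy)^3, [x,y]^4, t^2, [t^{x^2}, y x⁻¹], [t, y],
 (y t^{x^2})^5, (x y x^2 t^x)^5, (x t)^8`,
where `a ^ b := b⁻¹ a b` and `[a, b] := a⁻¹ b⁻¹ a b`.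
-/

namespace M22

abbrev F := FreeGroup (Fin 3)
def fx : F := FreeGroup.of 0
def fy : F := FreeGroup.of 1
def ft : F := FreeGroup.of 2

/-- conjugation `a ^ b = b⁻¹ * a * b` -/
def fconj (a b : F) : F := b⁻¹ * a * b
/-- commutator `[a, b] = a⁻¹ * b⁻¹ * a * b` -/
def fcomm (a b : F) : F := a⁻¹ * b⁻¹ * a * b

def rels : Set F :=
  {fx ^ 7, fy ^ 2, (fx * fy) ^ 3, (fcomm fx fy) ^ 4, ft ^ 2,
   fcomm (fconj ft (fx ^ 2)) (fy * fx⁻¹), fcomm ft fy,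
   (fy * fconj ft (fx ^ 2)) ^ 5, (fx * fy * fx ^ 2 * fconj ft fx) ^ 5,
   (fx * ft) ^ 8}

abbrev G := PresentedGroup rels

def x : G := PresentedGroup.of 0
def y : G := PresentedGroup.of 1
def t : G := PresentedGroup.of 2

/-- The symmetric generators `t₁, …, t₁₄`: for `1 ≤ i ≤ 7`, `tᵢ = t ^ (xⁱ)`,
and for `1 ≤ k ≤ 7`, `t₍₇₊ₖ₎ = t ^ (x⁵ y x^(k-1))`; the index is read modulo
`14` with representatives `1, …, 14`. -/
def tt (i : ℕ) : G :=
  let j := (i - 1) % 14 + 1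
  if j ≤ 7 then (x ^ j)⁻¹ * t * x ^ j
  else (x ^ 5 * y * x ^ (j - 8))⁻¹ * t * (x ^ 5 * y * x ^ (j - 8))

/-- `sᵢ = tᵢ t₍ᵢ₊₇₎`. -/
def s (i : ℕ) : G := tt i * tt (i + 7)

/-- the subgroup `𝓜 = ⟨x, y, s₁⟩` of `G`, where `s₁ = t₁ t₈` -/
def M : Subgroup G := Subgroup.closure {x, y, s 1}

/-- the subgroup `S = ⟨s₁, …, s₇⟩` of `G` -/
def S : Subgroup G := Subgroup.closure (s '' Set.Icc 1 7)




/-! ### A permutation representation on 22 points -/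

def tabx : Fin 22 → Fin 22 :=
  ![13, 0, 17, 1, 5, 2, 3, 12, 9, 4, 10, 21, 6, 7, 8, 18, 11, 14, 20, 15, 16, 19]
def tabX : Fin 22 → Fin 22 :=
  ![1, 3, 5, 6, 9, 4, 12, 13, 14, 8, 10, 16, 7, 0, 17, 19, 20, 2, 15, 21, 18, 11]
def taby : Fin 22 → Fin 22 :=
  ![1, 0, 4, 7, 2, 10, 6, 3, 9, 8, 5, 15, 12, 13, 17, 11, 16, 14, 20, 19, 18, 21]
def tabt : Fin 22 → Fin 22 :=
  ![2, 4, 0, 8, 1, 11, 6, 9, 3, 7, 15, 5, 12, 13, 18, 10, 16, 20, 14, 19, 17, 21]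

def permx : Equiv.Perm (Fin 22) := ⟨tabx, tabX, by decide, by decide⟩
def permy : Equiv.Perm (Fin 22) := ⟨taby, taby, by decide, by decide⟩
def permt : Equiv.Perm (Fin 22) := ⟨tabt, tabt, by decide, by decide⟩

def permGen : Fin 3 → Equiv.Perm (Fin 22) := ![permx, permy, permt]

set_option maxRecDepth 100000 in
theorem permGen_rels : ∀ r ∈ rels, FreeGroup.lift permGen r = 1 := by
  intro r hr
  simp only [rels, Set.mem_insert_iff, Set.mem_singleton_iff] at hr
  rcases hr with h | h | h | h | h | h | h | h | h | h <;> subst h <;>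
  simp only [fcomm, fconj, fx, fy, ft, map_mul, map_pow, map_inv, FreeGroup.lift_apply_of] <;>
  decide

/-- the representation `G → Sym(22)` -/
def phi : G →* Equiv.Perm (Fin 22) := PresentedGroup.toGroup permGen_rels

theorem phi_x : phi x = permx := PresentedGroup.toGroup.of permGen_rels
theorem phi_y : phi y = permy := PresentedGroup.toGroup.of permGen_rels
theorem phi_t : phi t = permt := PresentedGroup.toGroup.of permGen_rels

/-! ### The relations in `G` -/

theorem rel_one {r : F} (h : r ∈ rels) : PresentedGroup.mk rels r = 1 :=
  PresentedGroup.one_of_mem h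

theorem rel_x : x ^ 7 = 1 := rel_one (r := fx ^ 7) (by simp [rels])
theorem rel_y : y ^ 2 = 1 := rel_one (r := fy ^ 2) (by simp [rels])
theorem rel_xy : (x * y) ^ 3 = 1 := rel_one (r := (fx * fy) ^ 3) (by simp [rels])
theorem rel_comm : (x⁻¹ * y⁻¹ * x * y) ^ 4 = 1 :=
  rel_one (r := (fcomm fx fy) ^ 4) (by simp [rels])
theorem rel_t : t ^ 2 = 1 := rel_one (r := ft ^ 2) (by simp [rels])
theorem rel_tz : ((x ^ 2)⁻¹ * t * x ^ 2)⁻¹ * (y * x⁻¹)⁻¹ * ((x ^ 2)⁻¹ * t * x ^ 2) * (y * x⁻¹) = 1 :=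
  rel_one (r := fcomm (fconj ft (fx ^ 2)) (fy * fx⁻¹)) (by simp [rels])
theorem rel_ty : t⁻¹ * y⁻¹ * t * y = 1 := rel_one (r := fcomm ft fy) (by simp [rels])
theorem rel_R1 : (y * ((x ^ 2)⁻¹ * t * x ^ 2)) ^ 5 = 1 :=
  rel_one (r := (fy * fconj ft (fx ^ 2)) ^ 5) (by simp [rels])
theorem rel_R2 : (x * y * x ^ 2 * (x⁻¹ * t * x)) ^ 5 = 1 :=
  rel_one (r := (fx * fy * fx ^ 2 * fconj ft fx) ^ 5) (by simp [rels])

theorem yy : y * y = 1 := by rw [← pow_two]; exact rel_y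
theorem y_inv : y⁻¹ = y := inv_eq_of_mul_eq_one_left yy
theorem t_inv : t⁻¹ = t := inv_eq_of_mul_eq_one_left (by rw [← pow_two]; exact rel_t)
theorem t_y : t * y = y * t := by
  have := rel_ty
  rw [mul_assoc, mul_assoc, inv_mul_eq_one] at this
  have h2 : y * t = t * y := by
    conv_lhs => rw [this]
    group
  exact h2.symm
theorem t_z : t * (x ^ 2 * y * (x ^ 3)⁻¹) = x ^ 2 * y * (x ^ 3)⁻¹ * t := by
  have := rel_tz
  rw [mul_assoc, mul_assoc, inv_mul_eq_one, eq_inv_mul_iff_mul_eq] at this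
  calc t * (x ^ 2 * y * (x ^ 3)⁻¹)
      = x ^ 2 * ((x ^ 2)⁻¹ * t * x ^ 2 * (y * x⁻¹)) * (x ^ 2)⁻¹ := by group
    _ = _ := by rw [← this]; group

/-! ### Words in `x, y, x⁻¹` -/

def gen : Fin 3 → G := ![x, y, x⁻¹]
def nv (l : List (Fin 3)) : G := (l.map gen).prod
def ptab : Fin 3 → Fin 22 → Fin 22 := ![tabx, taby, tabX]
def pv (l : List (Fin 3)) (i : Fin 22) : Fin 22 := l.foldr ptab i

theorem nv_append (a b : List (Fin 3)) : nv (a ++ b) = nv a * nv b := by simp [nv]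
theorem nv_cons (a : Fin 3) (b : List (Fin 3)) : nv (a :: b) = gen a * nv b := by simp [nv]
theorem nv_nil : nv [] = 1 := rfl

theorem phi_gen (g : Fin 3) (i : Fin 22) : phi (gen g) i = ptab g i := by
  fin_cases g
  · simp [gen, ptab, phi_x, permx]
  · simp [gen, ptab, phi_y, permy]
  · simp only [gen, ptab]
    change phi x⁻¹ i = tabX i
    rw [map_inv, phi_x]; rfl

theorem phi_nv (l : List (Fin 3)) (i : Fin 22) : phi (nv l) i = pv l i := by
  induction l with
  | nil => simp [nv, pv]
  | cons a l ih => rw [nv_cons, map_mul, Equiv.Perm.mul_apply, ih, phi_gen]; rfl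

/-- the control subgroup `N = ⟨x, y⟩` -/
def N : Subgroup G := Subgroup.closure {x, y}

theorem x_mem : x ∈ N := Subgroup.subset_closure (by simp)
theorem y_mem : y ∈ N := Subgroup.subset_closure (by simp)
theorem gen_mem (g : Fin 3) : gen g ∈ N := by
  fin_cases g
  · exact x_mem
  · exact y_mem
  · exact N.inv_mem x_mem
theorem nv_mem (l : List (Fin 3)) : nv l ∈ N := by
  induction l with
  | nil => exact N.one_mem
  | cons a l ih => rw [nv_cons]; exact N.mul_mem (gen_mem a) ih

/-- representatives of the 24 left cosets of `⟨x⟩` in `N` -/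
def rep : Fin 24 → List (Fin 3) := ![
  [],
  [1],
  [0, 1],
  [0, 0, 1],
  [2, 1],
  [1, 0, 0, 1],
  [2, 1, 0, 0, 1],
  [2, 2, 1, 0, 0, 1],
  [1, 2, 1, 0, 0, 1],
  [2, 2, 1],
  [0, 0, 0, 1],
  [0, 1, 2, 1, 0, 0, 1],
  [0, 1, 0, 0, 1],
  [2, 2, 2, 1],
  [1, 0, 0, 0, 1],
  [2, 2, 2, 1, 0, 0, 1],
  [0, 0, 1, 0, 0, 1],
  [1, 2, 2, 2, 1],
  [2, 1, 0, 0, 0, 1],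
  [1, 2, 2, 1, 0, 0, 1],
  [2, 2, 1, 0, 0, 0, 1],
  [1, 2, 2, 2, 1, 0, 0, 1],
  [0, 1, 2, 2, 2, 1],
  [1, 2, 2, 1, 0, 0, 0, 1]]

/-! ### Coset enumeration of `N` over `⟨x⟩` -/

section TC

theorem act_rx (q : G ⧸ Subgroup.zpowers x) : x • x • x • x • x • x • x • q = q := by
  simp only [smul_smul]
  have : x * (x * (x * (x * (x * (x * x))))) = 1 := by
    rw [← rel_x]; simp only [pow_succ, pow_zero, one_mul, mul_assoc]
  simp only [← mul_assoc] at this ⊢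
  rw [this, one_smul]
theorem act_xy (q : G ⧸ Subgroup.zpowers x) : x • y • x • y • x • y • q = q := by
  simp only [smul_smul]
  have : x * (y * (x * (y * (x * y)))) = 1 := by
    rw [← rel_xy]; simp only [pow_succ, pow_zero, one_mul, mul_assoc]
  simp only [← mul_assoc] at this ⊢
  rw [this, one_smul]
theorem act_yy (q : G ⧸ Subgroup.zpowers x) : y • y • q = q := by
  rw [smul_smul, yy, one_smul]
theorem act_comm (q : G ⧸ Subgroup.zpowers x) :
    x⁻¹ • y • x • y • x⁻¹ • y • x • y • x⁻¹ • y • x • y • x⁻¹ • y • x • y • q = q := by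
  have := rel_comm
  rw [y_inv] at this
  have h : q = (x⁻¹ * y * x * y) ^ 4 • q := by rw [this, one_smul]
  conv_rhs => rw [h]
  simp only [pow_succ, pow_zero, one_mul, mul_smul]

theorem tc (p : Fin 24 → G ⧸ Subgroup.zpowers x) (h0 : x • p 0 = p 0)
    (d1 : p 1 = y • p 0)
    (d2 : p 2 = x • p 1)
    (d3 : p 3 = x • p 2)
    (d4 : p 4 = x⁻¹ • p 1)
    (d5 : p 5 = y • p 3)
    (d6 : p 6 = x⁻¹ • p 5)
    (d7 : p 7 = x⁻¹ • p 6)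
    (d8 : p 8 = y • p 6)
    (d9 : p 9 = x⁻¹ • p 4)
    (d10 : p 10 = x • p 3)
    (d11 : p 11 = x • p 8)
    (d12 : p 12 = x • p 5)
    (d13 : p 13 = x⁻¹ • p 9)
    (d14 : p 14 = y • p 10)
    (d15 : p 15 = x⁻¹ • p 7)
    (d16 : p 16 = x • p 12)
    (d17 : p 17 = y • p 13)
    (d18 : p 18 = x⁻¹ • p 14)
    (d19 : p 19 = y • p 7)
    (d20 : p 20 = x⁻¹ • p 18)
    (d21 : p 21 = y • p 15)
    (d22 : p 22 = x • p 17)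
    (d23 : p 23 = y • p 20)
    : (∀ j, ∃ k, x • p j = p k) ∧ (∀ j, ∃ k, y • p j = p k) := by
  have H0 : x⁻¹ • p 0 = p 0 := by rw [inv_smul_eq_iff]; exact h0.symm
  have e1 : y • p 0 = p 1 := d1.symm
  have f1 : y • p 1 = p 0 := by rw [← e1, act_yy]
  have e2 : x • p 1 = p 2 := d2.symm
  have f2 : x⁻¹ • p 2 = p 1 := by rw [inv_smul_eq_iff]; exact e2.symm
  have e3 : x • p 2 = p 3 := d3.symm
  have f3 : x⁻¹ • p 3 = p 2 := by rw [inv_smul_eq_iff]; exact e3.symm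
  have e4 : x⁻¹ • p 1 = p 4 := d4.symm
  have f4 : x • p 4 = p 1 := by rw [← e4, smul_inv_smul]
  have e5 : y • p 2 = p 4 := by
    have h := act_xy (p 1)
    rw [f1, h0, e1, e2] at h
    rw [← eq_inv_smul_iff, e4] at h
    exact h
  have f5 : y • p 4 = p 2 := by rw [← e5, act_yy]
  have e6 : y • p 3 = p 5 := d5.symm
  have f6 : y • p 5 = p 3 := by rw [← e6, act_yy]
  have e7 : x⁻¹ • p 5 = p 6 := d6.symm
  have f7 : x • p 6 = p 5 := by rw [← e7, smul_inv_smul]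
  have e8 : x⁻¹ • p 6 = p 7 := d7.symm
  have f8 : x • p 7 = p 6 := by rw [← e8, smul_inv_smul]
  have e9 : y • p 6 = p 8 := d8.symm
  have f9 : y • p 8 = p 6 := by rw [← e9, act_yy]
  have e10 : x⁻¹ • p 4 = p 9 := d9.symm
  have f10 : x • p 9 = p 4 := by rw [← e10, smul_inv_smul]
  have e11 : x • p 3 = p 10 := d10.symm
  have f11 : x⁻¹ • p 10 = p 3 := by rw [inv_smul_eq_iff]; exact e11.symm
  have e12 : x • p 8 = p 11 := d11.symm
  have f12 : x⁻¹ • p 11 = p 8 := by rw [inv_smul_eq_iff]; exact e12.symm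
  have e13 : x • p 5 = p 12 := d12.symm
  have f13 : x⁻¹ • p 12 = p 5 := by rw [inv_smul_eq_iff]; exact e13.symm
  have e14 : y • p 12 = p 9 := by
    have h := act_xy (p 4)
    rw [f5, e3, e6, e13] at h
    rw [← eq_inv_smul_iff, e10] at h
    exact h
  have f14 : y • p 9 = p 12 := by rw [← e14, act_yy]
  have e15 : x⁻¹ • p 9 = p 13 := d13.symm
  have f15 : x • p 13 = p 9 := by rw [← e15, smul_inv_smul]
  have e16 : x • p 10 = p 13 := by
    have h := act_rx (p 13)
    rw [f15, f10, f4, e2, e3, e11] at h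
    exact h
  have f16 : x⁻¹ • p 13 = p 10 := by rw [inv_smul_eq_iff]; exact e16.symm
  have e17 : y • p 10 = p 14 := d14.symm
  have f17 : y • p 14 = p 10 := by rw [← e17, act_yy]
  have e18 : x • p 14 = p 8 := by
    have h := act_xy (p 8)
    rw [f9, f7, f6, e11, e17] at h
    exact h
  have f18 : x⁻¹ • p 8 = p 14 := by rw [inv_smul_eq_iff]; exact e18.symm
  have e19 : x⁻¹ • p 7 = p 15 := d15.symm
  have f19 : x • p 15 = p 7 := by rw [← e19, smul_inv_smul]
  have e20 : x • p 12 = p 16 := d16.symm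
  have f20 : x⁻¹ • p 16 = p 12 := by rw [inv_smul_eq_iff]; exact e20.symm
  have e21 : y • p 16 = p 11 := by
    have h := act_comm (p 8)
    rw [f9, f7, f6, f3, e5, f4, f1, H0, e1, e2, e5, e10, f14, e20] at h
    rw [inv_smul_eq_iff, e12] at h
    exact h
  have f21 : y • p 11 = p 16 := by rw [← e21, act_yy]
  have e22 : y • p 13 = p 17 := d17.symm
  have f22 : y • p 17 = p 13 := by rw [← e22, act_yy]
  have e23 : x • p 11 = p 17 := by
    have h := act_xy (p 17)
    rw [f22, f15, f14, e20, e21] at h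
    exact h
  have f23 : x⁻¹ • p 17 = p 11 := by rw [inv_smul_eq_iff]; exact e23.symm
  have e24 : x⁻¹ • p 14 = p 18 := d18.symm
  have f24 : x • p 18 = p 14 := by rw [← e24, smul_inv_smul]
  have e25 : y • p 7 = p 19 := d19.symm
  have f25 : y • p 19 = p 7 := by rw [← e25, act_yy]
  have e26 : x • p 16 = p 19 := by
    have h := act_xy (p 19)
    rw [f25, f8, e9, e12, f21] at h
    exact h
  have f26 : x⁻¹ • p 19 = p 16 := by rw [inv_smul_eq_iff]; exact e26.symm
  have e27 : x • p 19 = p 15 := by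
    have h := act_rx (p 15)
    rw [f19, f8, f7, e13, e20, e26] at h
    exact h
  have f27 : x⁻¹ • p 15 = p 19 := by rw [inv_smul_eq_iff]; exact e27.symm
  have e28 : x⁻¹ • p 18 = p 20 := d20.symm
  have f28 : x • p 20 = p 18 := by rw [← e28, smul_inv_smul]
  have e29 : y • p 15 = p 21 := d21.symm
  have f29 : y • p 21 = p 15 := by rw [← e29, act_yy]
  have e30 : x • p 21 = p 21 := by
    have h := act_xy (p 21)
    rw [f29, f19, e25, e27, e29] at h
    exact h
  have f30 : x⁻¹ • p 21 = p 21 := by rw [inv_smul_eq_iff]; exact e30.symm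
  have e31 : x • p 17 = p 22 := d22.symm
  have f31 : x⁻¹ • p 22 = p 17 := by rw [inv_smul_eq_iff]; exact e31.symm
  have e32 : x • p 22 = p 20 := by
    have h := act_rx (p 20)
    rw [f28, f24, e18, e12, e23, e31] at h
    exact h
  have f32 : x⁻¹ • p 20 = p 22 := by rw [inv_smul_eq_iff]; exact e32.symm
  have e33 : y • p 22 = p 18 := by
    have h := act_xy (p 14)
    rw [f17, e16, e22, e31] at h
    rw [← eq_inv_smul_iff, e24] at h
    exact h
  have f33 : y • p 18 = p 22 := by rw [← e33, act_yy]
  have e34 : y • p 20 = p 23 := d23.symm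
  have f34 : y • p 23 = p 20 := by rw [← e34, act_yy]
  have e35 : x • p 23 = p 23 := by
    have h := act_xy (p 23)
    rw [f34, f28, f33, e32, e34] at h
    exact h
  have f35 : x⁻¹ • p 23 = p 23 := by rw [inv_smul_eq_iff]; exact e35.symm
  constructor
  · intro j
    fin_cases j
    · exact ⟨0, h0⟩
    · exact ⟨2, e2⟩
    · exact ⟨3, e3⟩
    · exact ⟨10, e11⟩
    · exact ⟨1, f4⟩
    · exact ⟨12, e13⟩
    · exact ⟨5, f7⟩
    · exact ⟨6, f8⟩
    · exact ⟨11, e12⟩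
    · exact ⟨4, f10⟩
    · exact ⟨13, e16⟩
    · exact ⟨17, e23⟩
    · exact ⟨16, e20⟩
    · exact ⟨9, f15⟩
    · exact ⟨8, e18⟩
    · exact ⟨7, f19⟩
    · exact ⟨19, e26⟩
    · exact ⟨22, e31⟩
    · exact ⟨14, f24⟩
    · exact ⟨15, e27⟩
    · exact ⟨18, f28⟩
    · exact ⟨21, e30⟩
    · exact ⟨20, e32⟩
    · exact ⟨23, e35⟩
  · intro j
    fin_cases j
    · exact ⟨1, e1⟩
    · exact ⟨0, f1⟩
    · exact ⟨4, e5⟩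
    · exact ⟨5, e6⟩
    · exact ⟨2, f5⟩
    · exact ⟨3, f6⟩
    · exact ⟨8, e9⟩
    · exact ⟨19, e25⟩
    · exact ⟨6, f9⟩
    · exact ⟨12, f14⟩
    · exact ⟨14, e17⟩
    · exact ⟨16, f21⟩
    · exact ⟨9, e14⟩
    · exact ⟨17, e22⟩
    · exact ⟨10, f17⟩
    · exact ⟨21, e29⟩
    · exact ⟨11, e21⟩
    · exact ⟨13, f22⟩
    · exact ⟨22, f33⟩
    · exact ⟨7, f25⟩
    · exact ⟨23, e34⟩
    · exact ⟨15, f29⟩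
    · exact ⟨18, e33⟩
    · exact ⟨20, f34⟩
end TC



def repv (j : Fin 24) (a : Fin 7) : List (Fin 3) := rep j ++ List.replicate a 0

theorem pow_mod7 (k : ℤ) : ∃ a : Fin 7, x ^ k = x ^ (a : ℕ) := by
  refine ⟨⟨(k % 7).toNat, by omega⟩, ?_⟩
  have h1 : k = 7 * (k / 7) + k % 7 := by omega
  have h2 : ((k % 7).toNat : ℤ) = k % 7 := by omega
  conv_lhs => rw [h1]
  rw [zpow_add, zpow_mul, ← zpow_natCast x (k % 7).toNat, h2]
  have : x ^ (7 : ℤ) = 1 := by exact_mod_cast rel_x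
  rw [this, one_zpow, one_mul]

theorem nv_replicate (a : ℕ) : nv (List.replicate a 0) = x ^ a := by
  simp [nv, gen]

theorem N_form {g : G} (hg : g ∈ N) : ∃ j a, g = nv (repv j a) := by
  have key : ∀ g ∈ N, ∃ j, (g : G ⧸ Subgroup.zpowers x) = ((nv (rep j) : G) : G ⧸ Subgroup.zpowers x) := by
    obtain ⟨hx, hy⟩ := tc (fun j => ((nv (rep j) : G) : G ⧸ Subgroup.zpowers x))
      (by
        change ((x * 1 : G) : G ⧸ Subgroup.zpowers x) = ((1 : G) : G ⧸ Subgroup.zpowers x)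
        rw [mul_one, QuotientGroup.eq, mul_one]
        exact Subgroup.inv_mem _ (Subgroup.mem_zpowers x))
      rfl rfl rfl rfl rfl rfl rfl rfl rfl rfl rfl rfl rfl rfl rfl rfl rfl rfl rfl rfl rfl rfl rfl
    have hx' : ∀ (n : ℕ) (j : Fin 24), ∃ k, x ^ n • ((nv (rep j) : G) : G ⧸ Subgroup.zpowers x)
        = ((nv (rep k) : G) : G ⧸ Subgroup.zpowers x) := by
      intro n
      induction n with
      | zero => intro j; exact ⟨j, by simp⟩
      | succ n ih =>
        intro j
        obtain ⟨k, hk⟩ := hx j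
        obtain ⟨l, hl⟩ := ih k
        exact ⟨l, by rw [pow_succ, mul_smul, hk, hl]⟩
    intro g hg
    induction hg using Subgroup.closure_induction_left with
    | one => exact ⟨0, rfl⟩
    | mul_left z hz w hw ih =>
      obtain ⟨j, hj⟩ := ih
      have e : ((z * w : G) : G ⧸ Subgroup.zpowers x) = z • ((w : G) : G ⧸ Subgroup.zpowers x) := rfl
      rw [e, hj]
      rcases hz with rfl | hz
      · exact hx j
      · rw [Set.mem_singleton_iff] at hz; subst hz; exact hy j
    | inv_mul_cancel z hz w hw ih =>
      obtain ⟨j, hj⟩ := ih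
      have e : ((z⁻¹ * w : G) : G ⧸ Subgroup.zpowers x) = z⁻¹ • ((w : G) : G ⧸ Subgroup.zpowers x) := rfl
      rw [e, hj]
      rcases hz with rfl | hz
      · have : x⁻¹ = x ^ 6 := inv_eq_of_mul_eq_one_left (by rw [← pow_succ]; exact rel_x)
        rw [this]; exact hx' 6 j
      · rw [Set.mem_singleton_iff] at hz; subst hz; rw [y_inv]; exact hy j
  obtain ⟨j, hj⟩ := key g hg
  rw [eq_comm, QuotientGroup.eq] at hj
  obtain ⟨k, hk⟩ := Subgroup.mem_zpowers_iff.1 hj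
  obtain ⟨a, ha⟩ := pow_mod7 k
  refine ⟨j, a, ?_⟩
  rw [repv, nv_append, nv_replicate, ← ha, hk, mul_inv_cancel_left]

set_option maxRecDepth 100000 in
theorem repv_ker : ∀ j a, (pv (repv j a) 0 = 0 ∧ pv (repv j a) 1 = 1 ∧ pv (repv j a) 2 = 2) →
    j = 0 ∧ a = 0 := by
  decide +kernel

/-- numerical code of the permutation of a word -/
def code (l : List (Fin 3)) : ℕ :=
  ((pv l 0 : ℕ) * 22 + (pv l 1 : ℕ)) * 22 + (pv l 2 : ℕ)

set_option maxRecDepth 100000 in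
theorem code_nodup : ((List.finRange 24 ×ˢ List.finRange 7).map
    (fun q => code (repv q.1 q.2))).Nodup := by
  decide +kernel

theorem code_inj {q q' : Fin 24 × Fin 7} (h : code (repv q.1 q.2) = code (repv q'.1 q'.2)) :
    q = q' :=
  List.inj_on_of_nodup_map code_nodup (List.pair_mem_product.2 ⟨List.mem_finRange _, List.mem_finRange _⟩)
    (List.pair_mem_product.2 ⟨List.mem_finRange _, List.mem_finRange _⟩) h

theorem N_ker {g : G} (hg : g ∈ N) (h : phi g = 1) : g = 1 := by
  obtain ⟨j, a, rfl⟩ := N_form hg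
  have h' : ∀ i, pv (repv j a) i = i := fun i => by rw [← phi_nv, h]; rfl
  obtain ⟨rfl, rfl⟩ := repv_ker j a ⟨h' 0, h' 1, h' 2⟩
  rfl

theorem nv_eq {l l' : List (Fin 3)} (h : ∀ i, pv l i = pv l' i) : nv l = nv l' := by
  rw [← mul_inv_eq_one]
  apply N_ker (N.mul_mem (nv_mem _) (N.inv_mem (nv_mem _)))
  rw [map_mul, map_inv, mul_inv_eq_one]
  ext i
  rw [phi_nv, phi_nv, h]

/-! ### The fourteen symmetric generators -/

def T (i : Fin 14) : G := tt (i + 1)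

def uw : Fin 14 → List (Fin 3) := ![[0], [0, 0], [0, 0, 0], [0, 0, 0, 0], [0, 0, 0, 0, 0],
  [0, 0, 0, 0, 0, 0], [0, 0, 0, 0, 0, 0, 0],
  [0, 0, 0, 0, 0, 1], [0, 0, 0, 0, 0, 1, 0], [0, 0, 0, 0, 0, 1, 0, 0], [0, 0, 0, 0, 0, 1, 0, 0, 0],
  [0, 0, 0, 0, 0, 1, 0, 0, 0, 0], [0, 0, 0, 0, 0, 1, 0, 0, 0, 0, 0],
  [0, 0, 0, 0, 0, 1, 0, 0, 0, 0, 0, 0]]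

theorem T_eq (i : Fin 14) : T i = (nv (uw i))⁻¹ * t * nv (uw i) := by
  fin_cases i <;> simp [T, tt, uw, nv, gen, pow_succ, mul_assoc]

/-- the action of `x, y, x⁻¹` on the indices -/
def pl : Fin 3 → Fin 14 → Fin 14 :=
  ![![1, 2, 3, 4, 5, 6, 0, 8, 9, 10, 11, 12, 13, 7],
    ![11, 2, 1, 10, 7, 12, 6, 4, 9, 8, 3, 0, 5, 13],
    ![6, 0, 1, 2, 3, 4, 5, 13, 7, 8, 9, 10, 11, 12]]

/-- generators of the centralizer of `t` in `N` -/
def cw : Fin 3 → List (Fin 3) := ![[1], [0, 0, 1, 2, 2, 2], [0, 0, 0, 1, 2, 2]]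

theorem cw_comm (k : Fin 3) : t * nv (cw k) = nv (cw k) * t := by
  have hz := t_z
  have h1 : nv (cw 1) = x ^ 2 * y * (x ^ 3)⁻¹ := by
    simp [nv, cw, gen, pow_succ, mul_assoc]
  have h2 : nv (cw 2) = (x ^ 2 * y * (x ^ 3)⁻¹)⁻¹ := by
    simp [nv, cw, gen, pow_succ, mul_assoc, y_inv]
  fin_cases k
  · simpa [nv, cw, gen] using t_y
  · change t * nv (cw 1) = nv (cw 1) * t
    rw [h1]; exact hz
  · change t * nv (cw 2) = nv (cw 2) * t
    rw [h2]; exact (Commute.inv_right hz)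

def cword (l : List (Fin 3)) : List (Fin 3) := l.flatMap cw

theorem cword_comm (l : List (Fin 3)) : t * nv (cword l) = nv (cword l) * t := by
  induction l with
  | nil => simp [cword, nv]
  | cons a l ih =>
    have : cword (a :: l) = cw a ++ cword l := rfl
    rw [this, nv_append, ← mul_assoc, cw_comm, mul_assoc, ih, mul_assoc]

def ctab : Fin 2 → Fin 14 → List (Fin 3) :=
  ![fun _ => [],
    ![[1, 0, 2], [1], [2], [0, 2], [], [2, 0, 1], [0], [], [0, 2], [1, 0], [1, 0], [1, 0, 2],
      [2, 0, 1], [2, 0, 1]]]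

set_option maxRecDepth 100000 in
theorem act_check : ∀ (g : Fin 2) (i : Fin 14) (k : Fin 22),
    pv (uw i ++ [g.castSucc]) k = pv (cword (ctab g i) ++ uw (pl g.castSucc i)) k := by
  decide +kernel

theorem T_gen' (g : Fin 2) (i : Fin 14) :
    T i * gen g.castSucc = gen g.castSucc * T (pl g.castSucc i) := by
  have h := nv_eq (act_check g i)
  rw [nv_append, nv_append] at h
  have hg : nv [g.castSucc] = gen g.castSucc := by simp [nv]
  rw [hg] at h
  have hc := cword_comm (ctab g i)
  rw [T_eq, T_eq]
  have h3 : nv (uw (pl g.castSucc i)) = (nv (cword (ctab g i)))⁻¹ * (nv (uw i) * gen g.castSucc) := by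
    rw [h]; group
  rw [h3]
  have hc' : nv (cword (ctab g i)) * t * (nv (cword (ctab g i)))⁻¹ = t := by
    rw [← hc]; group
  calc (nv (uw i))⁻¹ * t * nv (uw i) * gen g.castSucc
      = (nv (uw i))⁻¹ * (nv (cword (ctab g i)) * t * (nv (cword (ctab g i)))⁻¹) * nv (uw i)
          * gen g.castSucc := by rw [hc']
    _ = _ := by group

theorem pl_inv : ∀ i, pl 0 (pl 2 i) = i := by decide

theorem T_gen (g : Fin 3) (i : Fin 14) : T i * gen g = gen g * T (pl g i) := by
  fin_cases g
  · exact T_gen' 0 i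
  · exact T_gen' 1 i
  · have h := T_gen' 0 (pl 2 i)
    change T i * x⁻¹ = x⁻¹ * T (pl 2 i)
    change T (pl 2 i) * x = x * T (pl 0 (pl 2 i)) at h
    rw [pl_inv] at h
    rw [eq_inv_mul_iff_mul_eq, ← mul_assoc, ← h, mul_inv_cancel_right]

theorem T_sq (i : Fin 14) : T i * T i = 1 := by
  rw [T_eq]
  have : t * t = 1 := by rw [← pow_two]; exact rel_t
  calc _ = (nv (uw i))⁻¹ * (t * t) * nv (uw i) := by group
    _ = 1 := by rw [this]; group

/-! ### Rewriting of words in the symmetric generators -/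

def pa (l : List (Fin 3)) (i : Fin 14) : Fin 14 := l.foldl (fun i g => pl g i) i

theorem T_nv (l : List (Fin 3)) : ∀ i, T i * nv l = nv l * T (pa l i) := by
  induction l with
  | nil => intro i; simp [nv, pa]
  | cons a l ih =>
    intro i
    rw [nv_cons, ← mul_assoc, T_gen, mul_assoc, ih, mul_assoc]; rfl

def ev (w : List (Fin 14)) : G := (w.map T).prod

theorem ev_append (a b : List (Fin 14)) : ev (a ++ b) = ev a * ev b := by simp [ev]
theorem ev_cons (a : Fin 14) (b : List (Fin 14)) : ev (a :: b) = T a * ev b := by simp [ev]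

theorem ev_nv (w : List (Fin 14)) (l : List (Fin 3)) : ev w * nv l = nv l * ev (w.map (pa l)) := by
  induction w with
  | nil => simp [ev]
  | cons a w ih => rw [ev_cons, mul_assoc, ih, ← mul_assoc, T_nv, List.map_cons, ev_cons, mul_assoc]

theorem ev_reverse (w : List (Fin 14)) : ev w.reverse = (ev w)⁻¹ := by
  induction w with
  | nil => simp [ev]
  | cons a w ih =>
    rw [List.reverse_cons, ev_append, ih, ev_cons a w, mul_inv_rev]
    congr 1
    simpa [ev] using eq_inv_of_mul_eq_one_left (T_sq a)

/-- free reduction -/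
def fr : List (Fin 14) → List (Fin 14)
  | [] => []
  | a :: w => match fr w with
    | [] => [a]
    | b :: v => if a = b then v else a :: b :: v

theorem ev_fr (w : List (Fin 14)) : ev (fr w) = ev w := by
  induction w with
  | nil => rfl
  | cons a w ih =>
    rw [ev_cons, ← ih, fr]
    cases h : fr w with
    | nil => simp [ev]
    | cons b v =>
      simp only
      split
      · next hab => subst hab; rw [ev_cons, ← mul_assoc, T_sq, one_mul]
      · rw [ev_cons]

def wi (l : List (Fin 3)) : List (Fin 3) := l.reverse.map ![2, 1, 0]

theorem nv_wi (l : List (Fin 3)) : nv (wi l) = (nv l)⁻¹ := by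
  induction l with
  | nil => simp [wi, nv]
  | cons a l ih =>
    have : wi (a :: l) = wi l ++ [![2, 1, 0] a] := by simp [wi]
    rw [this, nv_append, ih, nv_cons a l, mul_inv_rev]
    congr 1
    fin_cases a <;> simp [nv, gen, y_inv]

/-- `u = w v` where `w` is a word in `x, y` and `u, v` are words in the symmetric generators -/
def E (u : List (Fin 14)) (w : List (Fin 3)) (v : List (Fin 14)) : Prop := ev u = nv w * ev v

theorem E.refl (u : List (Fin 14)) : E u [] u := by simp [E, nv]

theorem E.symm {u w v} (h : E u w v) : E v (wi w) u := by
  unfold E at *; rw [h, nv_wi, inv_mul_cancel_left]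

theorem E.conj {u w v} (h : E u w v) (g : List (Fin 3)) :
    E (u.map (pa g)) (wi g ++ w ++ g) (v.map (pa g)) := by
  unfold E at *
  have h1 : ev (u.map (pa g)) = (nv g)⁻¹ * ev u * nv g := by
    rw [mul_assoc, ev_nv]; group
  rw [h1, h, nv_append, nv_append, nv_wi, mul_assoc, mul_assoc, ev_nv]
  group

theorem E.step {u w v} (h : E u w v) (a b : List (Fin 14)) {u' w' v'} (r : E u' w' v')
    (z : List (Fin 14)) (h1 : v = a ++ u' ++ b) (h2 : fr (a.map (pa w') ++ v' ++ b) = z) :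
    E u (w ++ w') z := by
  unfold E at *
  rw [h, ← h2, ev_fr, h1, nv_append]
  simp only [ev_append]
  rw [r, ← mul_assoc (ev a), ev_nv]
  group

theorem E.word {u w v} (h : E u w v) {w' : List (Fin 3)} (hw : ∀ k, pv w k = pv w' k) :
    E u w' v := by
  unfold E at *; rw [h, nv_eq hw]

theorem E.rot {r w} (h : E r w []) (a b : ℕ) :
    E ((r.drop a).take (r.length - a - b)) w
      ((r.take a).reverse.map (pa w) ++ ((r.drop a).drop (r.length - a - b)).reverse) := by
  unfold E at *
  have h0 : r = r.take a ++ ((r.drop a).take (r.length - a - b) ++ (r.drop a).drop (r.length - a - b)) := by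
    rw [List.take_append_drop, List.take_append_drop]
  have hn : ev [] = 1 := rfl
  rw [ev_append, ← mul_assoc, ← ev_nv, ev_reverse, ev_reverse]
  rw [hn, mul_one] at h
  rw [← h]
  conv_rhs => enter [1, 2]; rw [h0]
  simp only [ev_append]
  group

theorem mix (w l : List (Fin 3)) (u v : List (Fin 14)) :
    (nv w * ev u) * (nv l * ev v) = nv (w ++ l) * ev (u.map (pa l) ++ v) := by
  rw [nv_append, ev_append, mul_assoc, ← mul_assoc (ev u), ev_nv]
  simp only [mul_assoc]

theorem E_of_pow5 {l : List (Fin 3)} {i : Fin 14} {u : List (Fin 14)} {w : List (Fin 3)}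
    (h : (nv l * T i) ^ 5 = 1)
    (hu : (((([i].map (pa l) ++ [i]).map (pa l) ++ [i]).map (pa l) ++ [i]).map (pa l) ++ [i]) = u)
    (hw : ∀ k, pv (wi (l ++ l ++ l ++ l ++ l)) k = pv w k) : E u w [] := by
  have hi : T i = ev [i] := by simp [ev]
  rw [hi] at h
  simp only [pow_succ, pow_zero, one_mul, mix] at h
  rw [hu] at h
  have hw' := nv_eq hw
  rw [nv_wi] at hw'
  unfold E
  rw [← hw']
  have hn : ev [] = 1 := rfl
  rw [hn, mul_one]
  exact eq_inv_of_mul_eq_one_right h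

theorem R1 : E [1, 2, 1, 2, 1] [1] [] := by
  apply E_of_pow5 (l := [1]) (i := 1)
  · have h := rel_R1
    have h1 : (x ^ 2)⁻¹ * t * x ^ 2 = T 1 := by simp [T, tt]
    rw [h1] at h
    simpa [nv, gen] using h
  · decide +kernel
  · decide +kernel

theorem R2 : E [0, 11, 7, 4, 0] [2, 2, 1, 2] [] := by
  apply E_of_pow5 (l := [0, 1, 0, 0]) (i := 0)
  · have h := rel_R2
    have h1 : x⁻¹ * t * x = T 0 := by simp [T, tt]
    rw [h1] at h
    have h2 : nv [0, 1, 0, 0] = x * y * x ^ 2 := by simp [nv, gen, pow_succ, mul_assoc]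
    rw [h2]; exact h
  · decide +kernel
  · decide +kernel

theorem relA : T 0 * T 7 = T 7 * T 0 := by
  have s0 := E.refl [0, 1, 0, 7]
  have s1 := s0.step [] [0, 7] (((R1.rot 0 2).symm).conj [1, 0, 1, 0, 1]) [0, 1, 7]
    (by decide +kernel) (by decide +kernel)
  have s2 := s1.step [] [1, 7] (((R2.rot 0 1).symm).conj [1, 0, 0, 0, 0, 1, 0, 0, 1]) [0, 8]
    (by decide +kernel) (by decide +kernel)
  have s3 := s2.step [] [8] (((R1.rot 0 1).symm).conj [0, 0, 0, 1, 0, 0, 0, 0, 1]) [0, 8, 0]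
    (by decide +kernel) (by decide +kernel)
  have s4 := s3.step [] [8, 0] (((R2.rot 0 1).symm).conj [0, 0, 0, 1, 0, 0, 1, 0, 0]) [0, 1, 7, 0]
    (by decide +kernel) (by decide +kernel)
  have h : E [0, 1, 0, 7] [] [0, 1, 7, 0] := s4.word (by decide +kernel)
  simpa [E, ev, nv] using h

theorem relB' : E [1, 0, 7] [0, 0, 0, 0, 0, 1, 0, 0] [0, 7, 8] := by
  have s0 := E.refl [1, 0, 7]
  have s1 := s0.step [] [7] (((R2.rot 0 2).symm).conj [1, 0, 0, 0, 1, 0, 0, 0, 0]) [1, 7, 8, 7]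
    (by decide +kernel) (by decide +kernel)
  have s2 := s1.step [1] [7] (((R1.rot 0 2).symm).conj [1, 0, 1, 0, 0, 0, 1, 0]) [0, 7, 8]
    (by decide +kernel) (by decide +kernel)
  exact s2.word (by decide +kernel)

theorem relB : E [1, 0, 7, 8, 7, 0] [0, 0, 0, 0, 0, 1, 0, 0] [] := by
  have s0 := E.refl [1, 0, 7, 8, 7, 0]
  exact (s0.step [] [8, 7, 0] relB' [] (by decide +kernel) (by decide +kernel))

theorem relC : E [1, 5, 12] [0, 0, 0, 0, 0, 1, 0, 0] [0, 7, 1] := by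
  have s0 := E.refl [1, 5, 12]
  have s1 := s0.step [] [5, 12] (((R2.rot 0 1).symm).conj [0, 0, 1, 0, 1]) [1, 4, 8, 11, 5, 12]
    (by decide +kernel) (by decide +kernel)
  have s2 := s1.step [1, 4, 8] [] (((relB.rot 0 3)).conj [0, 0, 1, 0, 0, 1, 0, 0, 1]) [3, 4, 10, 5, 12, 4]
    (by decide +kernel) (by decide +kernel)
  have s3 := s2.step [3, 4] [4] (((relB.rot 0 3)).conj [1, 0, 1]) [3, 1, 5, 12, 3, 4]
    (by decide +kernel) (by decide +kernel)
  have s4 := s3.step [3, 1, 5, 12] [] (((R1.rot 0 2).symm).conj [0, 0]) [4, 1, 12, 5, 3, 4, 3]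
    (by decide +kernel) (by decide +kernel)
  have s5 := s4.step [4, 1] [4, 3] (((relB.rot 3 0).symm).conj [1, 0]) [1, 4, 10, 5, 12, 4, 3]
    (by decide +kernel) (by decide +kernel)
  have s6 := s5.step [1, 4, 10] [3] (((relB.rot 0 3).symm).conj [0, 0, 1, 0, 0, 1, 0, 0, 1]) [3, 4, 8, 11, 5, 12, 3]
    (by decide +kernel) (by decide +kernel)
  have s7 := s6.step [3] [5, 12, 3] (((R2.rot 0 2)).conj [0, 0, 0, 0]) [10, 4, 1, 5, 12, 3]
    (by decide +kernel) (by decide +kernel)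
  have s8 := s7.step [10, 4] [3] (((relB.rot 0 3)).conj [0, 0, 0, 1, 0, 0, 0, 0, 1, 0]) [11, 3, 5, 12, 8, 3]
    (by decide +kernel) (by decide +kernel)
  have s9 := s8.step [11] [8, 3] (((relB.rot 0 3)).conj [0, 0, 0, 0, 0, 1, 0, 0, 1, 0]) [8, 5, 12, 10, 8, 3]
    (by decide +kernel) (by decide +kernel)
  have s10 := s9.step [] [10, 8, 3] (((relB.rot 0 3)).conj [0, 0, 0, 1, 0, 0, 1]) [5, 12, 1, 10, 8, 3]
    (by decide +kernel) (by decide +kernel)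
  have s11 := s10.step [5, 12] [8, 3] (((R2.rot 0 2).symm).conj [0, 1, 0, 0, 0, 0, 1, 0, 0]) [0, 7, 1]
    (by decide +kernel) (by decide +kernel)
  exact s11.word (by decide +kernel)



/-! ### The subgroup `S` -/

def lo (i : Fin 7) : Fin 14 := ⟨i, by omega⟩
def hi (i : Fin 7) : Fin 14 := ⟨i + 7, by omega⟩

def sg (i : Fin 7) : G := T (lo i) * T (hi i)

theorem s_eq (i : Fin 7) : s (i + 1) = sg i := by
  fin_cases i <;> rfl

theorem eA (i : Fin 7) : E [lo i, hi i] [] [hi i, lo i] := by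
  have h : E [0, 7] [] [7, 0] := by simpa [E, ev, nv] using relA
  have h2 := h.conj (List.replicate i 0)
  fin_cases i <;> exact h2.word (by decide +kernel)

theorem sg_comm (i : Fin 7) : T (hi i) * T (lo i) = sg i := by
  have h := eA i
  simp only [E, ev, nv, List.map_cons, List.map_nil, List.prod_cons, List.prod_nil, mul_one,
    one_mul] at h
  exact h.symm

theorem sg_sq (i : Fin 7) : sg i * sg i = 1 := by
  conv_lhs => enter [2]; rw [← sg_comm]
  rw [sg, mul_assoc, ← mul_assoc (T (hi i)), T_sq, one_mul, T_sq]

theorem line0 : sg 0 * sg 1 = sg 5 := by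
  have hB := relB'
  have hC := relC
  simp only [E, ev, List.map_cons, List.map_nil, List.prod_cons, List.prod_nil, mul_one] at hB hC
  have h1 : sg 0 = T 0 * T 7 := rfl
  have h1' : sg 1 = T 8 * T 1 := (sg_comm 1).symm
  have h5 : sg 5 = T 5 * T 12 := rfl
  rw [← h5, ← mul_assoc (T 0), ← h1] at hC
  rw [← h1, ← mul_assoc (T 0), ← h1] at hB
  have e1 : T 1 * sg 5 * T 1 = T 1 * sg 0 * T 8 := by
    rw [hB, hC]
    simp only [mul_assoc, T_sq]
  rw [mul_assoc, mul_assoc, mul_left_cancel_iff] at e1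
  rw [h1', ← mul_assoc, ← e1, mul_assoc, T_sq, mul_one]

theorem line (i : Fin 7) : sg i * sg (i + 1) = sg (i + 5) := by
  have h : E [0, 7, 1, 8] [] [5, 12] := by
    have h1 : T 0 * T 7 * (T 1 * T 8) = T 5 * T 12 := line0
    simpa [E, ev, nv, mul_assoc] using h1
  have h2 := h.conj (List.replicate i 0)
  have h3 : E [lo i, hi i, lo (i + 1), hi (i + 1)] [] [lo (i + 5), hi (i + 5)] := by
    fin_cases i <;> exact h2.word (by decide +kernel)
  simp only [E, ev, nv, List.map_cons, List.map_nil, List.prod_cons, List.prod_nil, mul_one,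
    one_mul] at h3
  simpa only [sg, mul_assoc] using h3

theorem comm_of_invol {a b c : G} (h : a * b = c) (ha : a * a = 1) (hb : b * b = 1)
    (hc : c * c = 1) : a * b = b * a := by
  have h1 : c⁻¹ = c := inv_eq_of_mul_eq_one_left hc
  have h2 : a⁻¹ = a := inv_eq_of_mul_eq_one_left ha
  have h3 : b⁻¹ = b := inv_eq_of_mul_eq_one_left hb
  rw [h, ← h1, ← h, mul_inv_rev, h2, h3]

theorem c01 : sg 0 * sg 1 = sg 1 * sg 0 := comm_of_invol (line 0) (sg_sq _) (sg_sq _) (sg_sq _)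
theorem c12 : sg 1 * sg 2 = sg 2 * sg 1 := comm_of_invol (line 1) (sg_sq _) (sg_sq _) (sg_sq _)
theorem l20 : sg 2 * sg 0 = sg 3 := by
  have h : sg 2 * sg 3 = sg 0 := line 2
  rw [← h, ← mul_assoc, sg_sq, one_mul]
theorem c20 : sg 2 * sg 0 = sg 0 * sg 2 := comm_of_invol l20 (sg_sq _) (sg_sq _) (sg_sq _)

/-- normal form in `S` -/
def sv (a b c : Fin 2) : G := sg 0 ^ (a : ℕ) * sg 1 ^ (b : ℕ) * sg 2 ^ (c : ℕ)

theorem sg_sv (i : Fin 7) : ∃ a b c, sg i = sv a b c := by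
  have l0 : sg 0 * sg 1 = sg 5 := line 0
  have l1 : sg 1 * sg 2 = sg 6 := line 1
  have l4 : sg 4 * sg 5 = sg 2 := line 4
  fin_cases i
  · exact ⟨1, 0, 0, by simp [sv]⟩
  · exact ⟨0, 1, 0, by simp [sv]⟩
  · exact ⟨0, 0, 1, by simp [sv]⟩
  · exact ⟨1, 0, 1, by simp [sv, ← c20, l20]⟩
  · refine ⟨1, 1, 1, ?_⟩
    have : sg 4 = sg 2 * sg 5 := by rw [← l4, mul_assoc, sg_sq, mul_one]
    change sg 4 = _
    rw [this, ← l0]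
    simp [sv]
    rw [← mul_assoc, c20, mul_assoc, ← c12, mul_assoc]
  · exact ⟨1, 1, 0, by simp [sv, l0]⟩
  · exact ⟨0, 1, 1, by simp [sv, l1]⟩

theorem pow_fin2 {g : G} (h : g * g = 1) (a b : Fin 2) :
    g ^ (a : ℕ) * g ^ (b : ℕ) = g ^ ((a + b : Fin 2) : ℕ) := by
  fin_cases a <;> fin_cases b <;> simp [h]

theorem sv_mul (a b c a' b' c' : Fin 2) :
    sv a b c * sv a' b' c' = sv (a + a') (b + b') (c + c') := by
  have h01 : Commute (sg 0) (sg 1) := c01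
  have h12 : Commute (sg 1) (sg 2) := c12
  have h20 : Commute (sg 2) (sg 0) := c20
  unfold sv
  rw [← pow_fin2 (sg_sq 0), ← pow_fin2 (sg_sq 1), ← pow_fin2 (sg_sq 2)]
  have e1 := (h20.pow_pow c a').eq
  have e2 := (h01.symm.pow_pow b a').eq
  have e3 := (h12.symm.pow_pow c b').eq
  generalize sg 0 ^ (a : ℕ) = A at *
  generalize sg 0 ^ (a' : ℕ) = A' at *
  generalize sg 1 ^ (b : ℕ) = B at *
  generalize sg 1 ^ (b' : ℕ) = B' at *
  generalize sg 2 ^ (c : ℕ) = C at *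
  generalize sg 2 ^ (c' : ℕ) = C' at *
  calc A * B * C * (A' * B' * C') = A * B * (C * A') * B' * C' := by simp only [mul_assoc]
    _ = A * (B * A') * (C * B') * C' := by rw [e1]; simp only [mul_assoc]
    _ = _ := by rw [e2, e3]; simp only [mul_assoc]

theorem sv_zero : sv 0 0 0 = 1 := by simp [sv]

theorem sv_sq (a b c : Fin 2) : sv a b c * sv a b c = 1 := by
  rw [sv_mul, ← sv_zero]
  congr 1 <;> revert a b c <;> decide

theorem sg_mem (i : Fin 7) : sg i ∈ S := by
  rw [← s_eq]
  exact Subgroup.subset_closure ⟨_, ⟨by omega, by omega⟩, rfl⟩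

theorem sv_mem (a b c : Fin 2) : sv a b c ∈ S :=
  S.mul_mem (S.mul_mem (S.pow_mem (sg_mem _) _) (S.pow_mem (sg_mem _) _)) (S.pow_mem (sg_mem _) _)

theorem s_image {g : G} (hg : g ∈ s '' Set.Icc 1 7) : ∃ i, g = sg i := by
  obtain ⟨i, ⟨h1, h2⟩, rfl⟩ := hg
  refine ⟨⟨i - 1, by omega⟩, ?_⟩
  rw [← s_eq]
  congr 1
  simp only
  omega

theorem S_form {g : G} (hg : g ∈ S) : ∃ a b c, g = sv a b c := by
  unfold S at hg
  induction hg using Subgroup.closure_induction with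
  | mem z hz => obtain ⟨i, rfl⟩ := s_image hz; exact sg_sv i
  | one => exact ⟨0, 0, 0, sv_zero.symm⟩
  | mul z w _ _ hz hw =>
    obtain ⟨a, b, c, rfl⟩ := hz
    obtain ⟨a', b', c', rfl⟩ := hw
    exact ⟨_, _, _, sv_mul _ _ _ _ _ _⟩
  | inv z _ hz =>
    obtain ⟨a, b, c, rfl⟩ := hz
    exact ⟨a, b, c, inv_eq_of_mul_eq_one_left (sv_sq a b c)⟩

theorem sg_x (i : Fin 7) : sg i * x = x * sg (i + 1) := by
  have h1 := T_gen 0 (lo i)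
  have h2 := T_gen 0 (hi i)
  have e1 : pl 0 (lo i) = lo (i + 1) := (by decide : ∀ i, pl 0 (lo i) = lo (i + 1)) i
  have e2 : pl 0 (hi i) = hi (i + 1) := (by decide : ∀ i, pl 0 (hi i) = hi (i + 1)) i
  have eg : gen 0 = x := rfl
  rw [e1, eg] at h1; rw [e2, eg] at h2
  rw [sg, sg, mul_assoc, h2, ← mul_assoc, h1, mul_assoc]

theorem sg_y (i : Fin 7) : ∃ k, sg i * y = y * sg k := by
  have e : (∃ k, pl 1 (lo i) = lo k ∧ pl 1 (hi i) = hi k) ∨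
      (∃ k, pl 1 (lo i) = hi k ∧ pl 1 (hi i) = lo k) := by revert i; decide
  have h1 := T_gen 1 (lo i)
  have h2 := T_gen 1 (hi i)
  have eg : gen 1 = y := rfl
  rcases e with ⟨k, e1, e2⟩ | ⟨k, e1, e2⟩
  · refine ⟨k, ?_⟩
    rw [e1, eg] at h1; rw [e2, eg] at h2
    rw [sg, sg, mul_assoc, h2, ← mul_assoc, h1, mul_assoc]
  · refine ⟨k, ?_⟩
    rw [e1, eg] at h1; rw [e2, eg] at h2
    rw [← sg_comm k, sg, mul_assoc, h2, ← mul_assoc, h1, mul_assoc]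

theorem conj_mem_of {n : G} (h : ∀ i, n * sg i * n⁻¹ ∈ S) {g : G} (hg : g ∈ S) :
    n * g * n⁻¹ ∈ S := by
  unfold S at hg
  induction hg using Subgroup.closure_induction with
  | mem z hz => obtain ⟨i, rfl⟩ := s_image hz; exact h i
  | one => simp [S.one_mem]
  | mul z w _ _ hz hw =>
    have := S.mul_mem hz hw
    have e : n * z * n⁻¹ * (n * w * n⁻¹) = n * (z * w) * n⁻¹ := by group
    rwa [e] at this
  | inv z _ hz =>
    have := S.inv_mem hz
    have e : (n * z * n⁻¹)⁻¹ = n * z⁻¹ * n⁻¹ := by group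
    rwa [e] at this

theorem conj_x (g : G) (hg : g ∈ S) : x * g * x⁻¹ ∈ S := by
  apply conj_mem_of _ hg
  intro i
  have h := sg_x (i - 1)
  rw [sub_add_cancel] at h
  rw [← h, mul_inv_cancel_right]
  exact sg_mem _

theorem conj_x' (g : G) (hg : g ∈ S) : x⁻¹ * g * x ∈ S := by
  have := conj_mem_of (n := x⁻¹) (fun i => by
    rw [inv_inv, mul_assoc, sg_x, inv_mul_cancel_left]; exact sg_mem _) hg
  rwa [inv_inv] at this

theorem conj_y (g : G) (hg : g ∈ S) : y * g * y⁻¹ ∈ S := by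
  apply conj_mem_of _ hg
  intro i
  obtain ⟨k, hk⟩ := sg_y i
  rw [y_inv, mul_assoc, hk, ← mul_assoc, yy, one_mul]
  exact sg_mem _

/-- conjugation by elements of `M` preserves `S`, in both directions -/
theorem conj_M {m : G} (hm : m ∈ M) :
    ∀ g ∈ S, m * g * m⁻¹ ∈ S ∧ m⁻¹ * g * m ∈ S := by
  unfold M at hm
  induction hm using Subgroup.closure_induction with
  | mem z hz =>
    intro g hg
    rcases hz with rfl | rfl | hz
    · exact ⟨conj_x g hg, conj_x' g hg⟩
    · have := conj_y g hg
      exact ⟨this, by rw [y_inv] at this ⊢; exact this⟩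
    · rw [Set.mem_singleton_iff] at hz
      have : z ∈ S := by rw [hz]; exact sg_mem 0
      exact ⟨S.mul_mem (S.mul_mem this hg) (S.inv_mem this),
        S.mul_mem (S.mul_mem (S.inv_mem this) hg) this⟩
  | one => intro g hg; simpa using hg
  | mul z w _ _ hz hw =>
    intro g hg
    have h1 := (hz _ (hw g hg).1).1
    have h2 := (hw _ (hz g hg).2).2
    have e1 : z * (w * g * w⁻¹) * z⁻¹ = z * w * g * (z * w)⁻¹ := by group
    have e2 : w⁻¹ * (z⁻¹ * g * z) * w = (z * w)⁻¹ * g * (z * w) := by group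
    rw [e1] at h1; rw [e2] at h2
    exact ⟨h1, h2⟩
  | inv z _ hz =>
    intro g hg
    have := hz g hg
    rw [inv_inv]
    exact ⟨this.2, this.1⟩

theorem x_mem_M : x ∈ M := Subgroup.subset_closure (by simp)
theorem y_mem_M : y ∈ M := Subgroup.subset_closure (by simp)

theorem N_le_M : N ≤ M := by
  unfold N
  rw [Subgroup.closure_le]
  rintro z (rfl | hz)
  · exact x_mem_M
  · rw [Set.mem_singleton_iff] at hz; subst hz; exact y_mem_M

theorem sg_mem_M (i : Fin 7) : sg i ∈ M := by
  have h0 : sg 0 ∈ M := Subgroup.subset_closure (by right; right; exact (s_eq 0).symm)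
  have hs : ∀ i, sg i ∈ M → sg (i + 1) ∈ M := by
    intro i hi
    have : sg (i + 1) = x⁻¹ * (sg i * x) := by rw [sg_x, inv_mul_cancel_left]
    rw [this]
    exact M.mul_mem (M.inv_mem x_mem_M) (M.mul_mem hi x_mem_M)
  have h1 := hs _ h0
  have h2 := hs _ h1
  have h3 := hs _ h2
  have h4 := hs _ h3
  have h5 := hs _ h4
  have h6 := hs _ h5
  fin_cases i <;> assumption

theorem S_le_M : S ≤ M := by
  unfold S
  rw [Subgroup.closure_le]
  intro z hz
  obtain ⟨i, rfl⟩ := s_image hz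
  exact sg_mem_M i

theorem M_form {m : G} (hm : m ∈ M) : ∃ n ∈ N, ∃ g ∈ S, m = n * g := by
  unfold M at hm
  induction hm using Subgroup.closure_induction with
  | mem z hz =>
    rcases hz with rfl | rfl | hz
    · exact ⟨_, x_mem, 1, S.one_mem, by simp⟩
    · exact ⟨_, y_mem, 1, S.one_mem, by simp⟩
    · rw [Set.mem_singleton_iff] at hz
      exact ⟨1, N.one_mem, z, by rw [hz]; exact sg_mem 0, by simp⟩
  | one => exact ⟨1, N.one_mem, 1, S.one_mem, by simp⟩
  | mul z w _ _ hz hw =>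
    obtain ⟨n, hn, g, hg, rfl⟩ := hz
    obtain ⟨n', hn', g', hg', rfl⟩ := hw
    exact ⟨n * n', N.mul_mem hn hn', n'⁻¹ * g * n' * g',
      S.mul_mem (conj_M (N_le_M hn') g hg).2 hg', by group⟩
  | inv z _ hz =>
    obtain ⟨n, hn, g, hg, rfl⟩ := hz
    exact ⟨n⁻¹, N.inv_mem hn, n * g⁻¹ * n⁻¹, (conj_M (N_le_M hn) _ (S.inv_mem hg)).1, by group⟩

/-! ### Lower bounds -/

def permT (i : Fin 14) (k : Fin 22) : Fin 22 := pv (wi (uw i)) (tabt (pv (uw i) k))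
def permS (i : Fin 7) (k : Fin 22) : Fin 22 := permT (lo i) (permT (hi i) k)
def permV (a b c : Fin 2) (k : Fin 22) : Fin 22 :=
  (permS 0)^[a] ((permS 1)^[b] ((permS 2)^[c] k))

theorem phi_T (i : Fin 14) (k : Fin 22) : phi (T i) k = permT i k := by
  rw [T_eq, ← nv_wi, map_mul, map_mul, Equiv.Perm.mul_apply, Equiv.Perm.mul_apply, phi_nv, phi_nv,
    phi_t]
  rfl

theorem phi_sg (i : Fin 7) (k : Fin 22) : phi (sg i) k = permS i k := by
  rw [sg, map_mul, Equiv.Perm.mul_apply, phi_T, phi_T]; rfl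

theorem phi_sv (a b c : Fin 2) (k : Fin 22) : phi (sv a b c) k = permV a b c k := by
  have hp : ∀ (i : Fin 7) (n : Fin 2) (k : Fin 22), phi (sg i ^ (n : ℕ)) k = (permS i)^[n] k := by
    intro i n k
    fin_cases n
    · simp
    · simp [phi_sg]
  rw [sv, map_mul, map_mul, Equiv.Perm.mul_apply, Equiv.Perm.mul_apply, hp, hp, hp]; rfl

theorem sv_ker_check : ∀ a b c, permV a b c 0 = 0 → permV a b c 1 = 1 → permV a b c 2 = 2 →
    (a = 0 ∧ b = 0 ∧ c = 0) := by
  decide +kernel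

theorem inter_check : ∀ j a b c d, (∀ k, pv (repv j a) k = permV b c d k) →
    (b = 0 ∧ c = 0 ∧ d = 0) := by
  decide +kernel

theorem inter {g : G} (hn : g ∈ N) (hs : g ∈ S) : g = 1 := by
  obtain ⟨j, a, h⟩ := N_form hn
  obtain ⟨b, c, d, h'⟩ := S_form hs
  obtain ⟨rfl, rfl, rfl⟩ := inter_check j a b c d (fun k => by
    rw [← phi_nv, ← phi_sv, ← h, ← h'])
  rw [h', sv_zero]

theorem sv_inj {a b c a' b' c' : Fin 2} (h : sv a b c = sv a' b' c') :
    a = a' ∧ b = b' ∧ c = c' := by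
  have h1 : sv (a + a') (b + b') (c + c') = 1 := by
    rw [← sv_mul, h, sv_sq]
  have h2 : ∀ k, permV (a + a') (b + b') (c + c') k = k := fun k => by
    rw [← phi_sv, h1, map_one]; rfl
  have h3 := sv_ker_check _ _ _ (h2 0) (h2 1) (h2 2)
  have h4 : ∀ a b : Fin 2, a + b = 0 → a = b := by decide
  exact ⟨h4 _ _ h3.1, h4 _ _ h3.2.1, h4 _ _ h3.2.2⟩

theorem repv_inj {j j' : Fin 24} {a a' : Fin 7} (h : nv (repv j a) = nv (repv j' a')) :
    j = j' ∧ a = a' := by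
  have : code (repv j a) = code (repv j' a') := by
    unfold code
    simp only [← phi_nv, h]
  have := code_inj (q := (j, a)) (q' := (j', a')) this
  exact Prod.mk.inj this

theorem card_S : Nat.card S = 8 := by
  let f : Fin 2 × Fin 2 × Fin 2 → S := fun q => ⟨sv q.1 q.2.1 q.2.2, sv_mem _ _ _⟩
  have hf : Function.Bijective f := by
    constructor
    · rintro ⟨a, b, c⟩ ⟨a', b', c'⟩ h
      obtain ⟨rfl, rfl, rfl⟩ := sv_inj (Subtype.mk.inj h)
      rfl
    · rintro ⟨g, hg⟩
      obtain ⟨a, b, c, rfl⟩ := S_form hg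
      exact ⟨(a, b, c), rfl⟩
  rw [← Nat.card_eq_of_bijective f hf]
  simp

theorem card_N : Nat.card N = 168 := by
  let f : Fin 24 × Fin 7 → N := fun q => ⟨nv (repv q.1 q.2), nv_mem _⟩
  have hf : Function.Bijective f := by
    constructor
    · rintro ⟨a, b⟩ ⟨a', b'⟩ h
      obtain ⟨rfl, rfl⟩ := repv_inj (Subtype.mk.inj h)
      rfl
    · rintro ⟨g, hg⟩
      obtain ⟨a, b, rfl⟩ := N_form hg
      exact ⟨(a, b), rfl⟩
  rw [← Nat.card_eq_of_bijective f hf]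
  simp

theorem card_M : Nat.card M = 1344 := by
  let f : N × S → M := fun q => ⟨q.1 * q.2, M.mul_mem (N_le_M q.1.2) (S_le_M q.2.2)⟩
  have hf : Function.Bijective f := by
    constructor
    · rintro ⟨⟨n, hn⟩, ⟨g, hg⟩⟩ ⟨⟨n', hn'⟩, ⟨g', hg'⟩⟩ h
      have h : n * g = n' * g' := Subtype.mk.inj h
      have h1 : n'⁻¹ * n = g' * g⁻¹ := by
        rw [inv_mul_eq_iff_eq_mul, ← mul_assoc, ← h, mul_inv_cancel_right]
      have h2 : n'⁻¹ * n = 1 := inter (N.mul_mem (N.inv_mem hn') hn)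
        (by rw [h1]; exact S.mul_mem hg' (S.inv_mem hg))
      have h3 : n' = n := inv_mul_eq_one.1 h2
      subst h3
      have h4 : g = g' := mul_left_cancel h
      subst h4
      rfl
    · rintro ⟨m, hm⟩
      obtain ⟨n, hn, g, hg, rfl⟩ := M_form hm
      exact ⟨(⟨n, hn⟩, ⟨g, hg⟩), rfl⟩
  rw [← Nat.card_eq_of_bijective f hf, Nat.card_prod, card_N, card_S]


/-- `𝓜 = ⟨x, y, s₁⟩` has order `1344` (it is isomorphic to `2³:L₃(2)`), and
`S = ⟨s₁, …, s₇⟩` is a normal subgroup of `𝓜` which is elementary abelian of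
order `8`. -/
theorem M_card_and_S :
    Nat.card M = 1344 ∧ S ≤ M ∧
    (∀ m ∈ M, ∀ g ∈ S, m⁻¹ * g * m ∈ S) ∧
    (∀ a ∈ S, ∀ b ∈ S, a * b = b * a) ∧
    (∀ g ∈ S, g ^ 2 = 1) ∧
    Nat.card S = 8 := by
  refine ⟨card_M, S_le_M, fun m hm g hg => (conj_M hm g hg).2, ?_, ?_, card_S⟩
  · intro a ha b hb
    obtain ⟨a1, a2, a3, rfl⟩ := S_form ha
    obtain ⟨b1, b2, b3, rfl⟩ := S_form hb
    rw [sv_mul, sv_mul, add_comm a1, add_comm a2, add_comm a3]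
  · intro g hg
    obtain ⟨a, b, c, rfl⟩ := S_form hg
    rw [pow_two, sv_sq]

end M22
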